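/- Let d ∈ ℤ_{>0} and let X = [[z√ε, u√ε],[v√ε, z√ε]] with z, u, v ∈ F, ν(z) ≥ −d and ν(v) > ν(u) = −d. Then { k ∈ K : Ψ_X(k·g·k^{-1}) = Ψ_X(g) for all g ∈ K_{⌊d/2⌋+1} } = T(X)·K_{⌈d/2⌉}, i.e., the set of products t·h with t ∈ T(X) and h ∈ K_{⌈d/2⌉}. -/

import Mathlib

open Matrix

noncomputable section

/-- A 2×2 matrix over `E`. -/
abbrev Mat (E : Type) := Matrix (Fin 2) (Fin 2) E

/-- The context: `E/F` is the unramified quadratic extension of a finite extension `F` of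
`ℚ_p` (`p` odd), encoded via the Galois involution `sig` (whose fixed field is `F`),
the valuation `nu` (normalized by `nu ϖ = 1` for a uniformizer `ϖ` of `F`),
a square root `sqeps` of a non-square unit `eps = sqeps^2` of `O_F`, the residue-field
cardinality `q` of `F`, and an additive character `psi'` of `F` trivial on `p_F` and
nontrivial on `O_F`. -/
structure USetting (E : Type) [Field E] where
  sig : E →+* E
  nu : E → WithTop ℤ
  sqeps : E
  pi : E
  q : ℕ
  psi' : E → ℂ
  sig_invol : ∀ x, sig (sig x) = x
  sig_ne : ∃ x, sig x ≠ x
  nu_eq_top : ∀ x, nu x = ⊤ ↔ x = 0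
  nu_mul : ∀ x y, nu (x * y) = nu x + nu y
  nu_add : ∀ x y, min (nu x) (nu y) ≤ nu (x + y)
  nu_sig : ∀ x, nu (sig x) = nu x
  nu_pi : nu pi = 1
  sig_pi : sig pi = pi
  sig_sqeps : sig sqeps = - sqeps
  nu_sqeps : nu sqeps = 0
  eps_not_square : ∀ y, sig y = y → y * y ≠ sqeps * sqeps
  gen : ∀ x : E, ∃ a b, sig a = a ∧ sig b = b ∧ x = a + b * sqeps
  nu_two : nu 2 = 0
  charzero : ∀ n : ℕ, (n : E) = 0 → n = 0
  complete : ∀ f : ℕ → E, (∀ n : ℕ, ((n : ℤ) : WithTop ℤ) ≤ nu (f (n + 1) - f n)) →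
    ∃ L, ∀ n : ℕ, ((n : ℤ) : WithTop ℤ) ≤ nu (L - f n)
  res_card : ∃ R : Finset E, R.card = q ∧ (∀ x ∈ R, sig x = x ∧ 0 ≤ nu x) ∧
    ∀ y : E, sig y = y → 0 ≤ nu y → ∃! x, x ∈ R ∧ 1 ≤ nu (y - x)
  psi'_mul : ∀ x y, sig x = x → sig y = y → psi' (x + y) = psi' x * psi' y
  psi'_ne : ∀ x, sig x = x → psi' x ≠ 0
  psi'_triv : ∀ x, sig x = x → 1 ≤ nu x → psi' x = 1
  psi'_nontriv : ∃ x, sig x = x ∧ 0 ≤ nu x ∧ psi' x ≠ 1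

variable {E : Type} [Field E]

/-- The matrix `w₀ = [[0,1],[1,0]]`. -/
def w0 (E : Type) [Field E] : Mat E := !![0, 1; 1, 0]

/-- `G = U(1,1)(F)`. -/
def Gset (S : USetting E) : Set (Mat E) :=
  {g | (g.map ⇑S.sig)ᵀ * w0 E * g = w0 E}

/-- `K = G ∩ GL₂(O_E)`: entries in `O_E` and determinant in `O_E^×`. -/
def Kset (S : USetting E) : Set (Mat E) :=
  {g | g ∈ Gset S ∧ (∀ i j, 0 ≤ S.nu (g i j)) ∧ S.nu g.det = 0}

/-- The congruence filtration subgroup `K_n` (for `n ≥ 1`; `K_0 = K` as a set). -/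
def Kfil (S : USetting E) (n : ℤ) : Set (Mat E) :=
  {g | g ∈ Kset S ∧ ∀ i j, (n : WithTop ℤ) ≤ S.nu ((g - 1) i j)}

/-- `𝓑 = B ∩ K`, the upper triangular matrices in `K`. -/
def Bcal (S : USetting E) : Set (Mat E) := {g | g ∈ Kset S ∧ g 1 0 = 0}

/-- `E^1`, the norm-one elements of `E`. -/
def E1set (S : USetting E) : Set E := {x | x * S.sig x = 1}

/-- `O_F^×` as a subset of `E`. -/
def OFunits (S : USetting E) : Set E := {x | S.sig x = x ∧ S.nu x = 0}

/-- `O_E^×` as a subset of `E`. -/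
def OEunits (S : USetting E) : Set E := {x | S.nu x = 0}

/-- A character of `E^×`, encoded as a function `E → ℂ` multiplicative and
nonvanishing on nonzero elements. -/
def IsChar (χ : E → ℂ) : Prop :=
  (∀ x y : E, x ≠ 0 → y ≠ 0 → χ (x * y) = χ x * χ y) ∧ ∀ x : E, x ≠ 0 → χ x ≠ 0

/-- A group homomorphism `E^1 → ℂ^×`, encoded as a function `E → ℂ`. -/
def IsE1Hom (S : USetting E) (φ : E → ℂ) : Prop :=
  (∀ x ∈ E1set S, ∀ y ∈ E1set S, φ (x * y) = φ x * φ y) ∧ ∀ x ∈ E1set S, φ x ≠ 0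

/-- A homomorphism into `ℂ^×` on a subset of matrices. -/
def IsHomOn (A : Set (Mat E)) (Ψ : Mat E → ℂ) : Prop :=
  (∀ x ∈ A, ∀ y ∈ A, Ψ (x * y) = Ψ x * Ψ y) ∧ ∀ x ∈ A, Ψ x ≠ 0

/-- `1 + p_E^n`. -/
def onePE (S : USetting E) (n : ℤ) : Set E := {x | (n : WithTop ℤ) ≤ S.nu (x - 1)}

/-- `1 + p_F^n`. -/
def onePF (S : USetting E) (n : ℤ) : Set E :=
  {x | S.sig x = x ∧ (n : WithTop ℤ) ≤ S.nu (x - 1)}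

/-- `χ` is trivial on a set. -/
def TrivOn (χ : E → ℂ) (s : Set E) : Prop := ∀ x ∈ s, χ x = 1

/-- `χ` has depth `r`: trivial on `1+p_E^{r+1}` and (if `r ≥ 1`) nontrivial on `1+p_E^r`. -/
def HasDepth (S : USetting E) (χ : E → ℂ) (r : ℕ) : Prop :=
  TrivOn χ (onePE S ((r : ℤ) + 1)) ∧ (r = 0 ∨ ¬ TrivOn χ (onePE S (r : ℤ)))

/-- `χ` has true depth `r`: the depth of its restriction to `F^×` is `r`. -/
def HasTrueDepth (S : USetting E) (χ : E → ℂ) (r : ℕ) : Prop :=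
  TrivOn χ (onePF S ((r : ℤ) + 1)) ∧ (r = 0 ∨ ¬ TrivOn χ (onePF S (r : ℤ)))

/-- `χ` has minimal depth `r`: its depth and true depth both equal `r`. -/
def MinDepth (S : USetting E) (χ : E → ℂ) (r : ℕ) : Prop :=
  HasDepth S χ r ∧ HasTrueDepth S χ r

/-- Right translation action on functions. -/
def rho (g : Mat E) : (Mat E → ℂ) →ₗ[ℂ] (Mat E → ℂ) where
  toFun f := fun k => f (k * g)
  map_add' _ _ := rfl
  map_smul' _ _ := rfl

/-- The space `V_χ^{K_n}`: functions on `K` (extended by zero off `K`) satisfying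
`f(bk) = χ(b₁₁) f(k)` for `b ∈ 𝓑` and right `K_n`-invariance. -/
def Vsp (S : USetting E) (χ : E → ℂ) (n : ℤ) : Submodule ℂ (Mat E → ℂ) where
  carrier := {f | (∀ x, x ∉ Kset S → f x = 0) ∧
    (∀ b ∈ Bcal S, ∀ k ∈ Kset S, f (b * k) = χ (b 0 0) * f k) ∧
    (∀ k ∈ Kset S, ∀ g ∈ Kfil S n, f (k * g) = f k)}
  add_mem' := by
    rintro f g ⟨hf0, hf1, hf2⟩ ⟨hg0, hg1, hg2⟩
    refine ⟨fun x hx => ?_, fun b hb k hk => ?_, fun k hk g' hg' => ?_⟩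
    · simp [hf0 x hx, hg0 x hx]
    · simp only [Pi.add_apply, hf1 b hb k hk, hg1 b hb k hk]; ring
    · simp only [Pi.add_apply, hf2 k hk g' hg', hg2 k hk g' hg']
  zero_mem' := by
    refine ⟨fun x _ => rfl, fun b _ k _ => by simp, fun k _ g _ => rfl⟩
  smul_mem' := by
    rintro c f ⟨hf0, hf1, hf2⟩
    refine ⟨fun x hx => ?_, fun b hb k hk => ?_, fun k hk g' hg' => ?_⟩
    · simp [hf0 x hx]
    · simp only [Pi.smul_apply, hf1 b hb k hk, smul_eq_mul]; ring
    · simp only [Pi.smul_apply, hf2 k hk g' hg']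

/-- The space of the representation induced from a character `Ψ` of a subgroup `H ⊆ K`:
functions on `K` (extended by zero) with `f(hk) = Ψ(h) f(k)`. -/
def IndSp (S : USetting E) (H : Set (Mat E)) (Ψ : Mat E → ℂ) : Submodule ℂ (Mat E → ℂ) where
  carrier := {f | (∀ x, x ∉ Kset S → f x = 0) ∧
    ∀ h ∈ H, ∀ k ∈ Kset S, f (h * k) = Ψ h * f k}
  add_mem' := by
    rintro f g ⟨hf0, hf1⟩ ⟨hg0, hg1⟩
    refine ⟨fun x hx => ?_, fun h hh k hk => ?_⟩
    · simp [hf0 x hx, hg0 x hx]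
    · simp only [Pi.add_apply, hf1 h hh k hk, hg1 h hh k hk]; ring
  zero_mem' := ⟨fun x _ => rfl, fun h _ k _ => by simp⟩
  smul_mem' := by
    rintro c f ⟨hf0, hf1⟩
    refine ⟨fun x hx => ?_, fun h hh k hk => ?_⟩
    · simp [hf0 x hx]
    · simp only [Pi.smul_apply, hf1 h hh k hk, smul_eq_mul]; ring

/-- The functions constant on `K` and zero off `K`. -/
def ConstSub (S : USetting E) : Submodule ℂ (Mat E → ℂ) where
  carrier := {f | (∀ x, x ∉ Kset S → f x = 0) ∧ ∃ c : ℂ, ∀ k ∈ Kset S, f k = c}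
  add_mem' := by
    rintro f g ⟨hf0, c, hc⟩ ⟨hg0, c', hc'⟩
    exact ⟨fun x hx => by simp [hf0 x hx, hg0 x hx],
      c + c', fun k hk => by simp [hc k hk, hc' k hk]⟩
  zero_mem' := ⟨fun x _ => rfl, 0, fun _ _ => rfl⟩
  smul_mem' := by
    rintro a f ⟨hf0, c, hc⟩
    exact ⟨fun x hx => by simp [hf0 x hx], a * c, fun k hk => by simp [hc k hk]⟩

/-- A subspace is `K`-invariant. -/
def KInvariant (S : USetting E) (W : Submodule ℂ (Mat E → ℂ)) : Prop :=
  ∀ g ∈ Kset S, ∀ f ∈ W, rho g f ∈ W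

/-- A subset `A ⊆ K` acts trivially on `W`. -/
def ActsTrivially (S : USetting E) (A : Set (Mat E)) (W : Submodule ℂ (Mat E → ℂ)) : Prop :=
  ∀ g ∈ A, ∀ f ∈ W, rho g f = f

/-- `W` is an irreducible representation of `K`. -/
def IsIrredRep (S : USetting E) (W : Submodule ℂ (Mat E → ℂ)) : Prop :=
  W ≠ ⊥ ∧ KInvariant S W ∧
    ∀ U : Submodule ℂ (Mat E → ℂ), U ≤ W → KInvariant S U → U = ⊥ ∨ U = W

/-- `V` and `W` are isomorphic as representations of `K`. -/
def RepIso (S : USetting E) (V W : Submodule ℂ (Mat E → ℂ)) : Prop :=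
  ∃ e : (Mat E → ℂ) →ₗ[ℂ] (Mat E → ℂ), Set.BijOn ⇑e ↑V ↑W ∧
    ∀ g ∈ Kset S, ∀ f ∈ V, e (rho g f) = rho g (e f)

/-- The space of `ℂ`-linear endomorphisms of `V` commuting with the right-translation
action of `K`, realized inside the function space `↥V → ↥V`. -/
def Commutant (S : USetting E) (V : Submodule ℂ (Mat E → ℂ)) :
    Submodule ℂ (↥V → ↥V) where
  carrier := {T | (∀ x y : ↥V, T (x + y) = T x + T y) ∧
    (∀ (c : ℂ) (x : ↥V), T (c • x) = c • T x) ∧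
    ∀ g ∈ Kset S, ∀ f : ↥V, ∀ h : rho g (f : Mat E → ℂ) ∈ V,
      ((T ⟨rho g (f : Mat E → ℂ), h⟩ : ↥V) : Mat E → ℂ) = rho g ((T f : ↥V) : Mat E → ℂ)}
  add_mem' := by
    rintro T T' ⟨hT1, hT2, hT3⟩ ⟨hT1', hT2', hT3'⟩
    refine ⟨fun x y => ?_, fun c x => ?_, fun g hg f h => ?_⟩
    · simp only [Pi.add_apply, hT1 x y, hT1' x y]; abel
    · simp only [Pi.add_apply, hT2 c x, hT2' c x, smul_add]
    · simp only [Pi.add_apply, Submodule.coe_add, hT3 g hg f h, hT3' g hg f h, map_add]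
  zero_mem' := by
    refine ⟨fun x y => by simp, fun c x => by simp, fun g hg f h => by simp⟩
  smul_mem' := by
    rintro c T ⟨hT1, hT2, hT3⟩
    refine ⟨fun x y => ?_, fun a x => ?_, fun g hg f h => ?_⟩
    · simp only [Pi.smul_apply, hT1 x y, smul_add]
    · simp only [Pi.smul_apply, hT2 a x, smul_comm c a]
    · simp only [Pi.smul_apply, Submodule.coe_smul, hT3 g hg f h, _root_.map_smul]

/-- The additive character `ψ` of `E`, `ψ(x) = ψ'((x + σ(x))/2)`. -/
def psiE (S : USetting E) (x : E) : ℂ := S.psi' ((x + S.sig x) / 2)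

/-- `Ψ_Y(g) = ψ(Tr(Y (g − 1)))`. -/
def PsiC (S : USetting E) (Y g : Mat E) : ℂ := psiE S ((Y * (g - 1)).trace)

/-- The Lie algebra `𝔤 = 𝔲(1,1)(F)`. -/
def gfrak (S : USetting E) : Set (Mat E) :=
  {Y | (Y.map ⇑S.sig)ᵀ * w0 E + w0 E * Y = 0}

/-- The lattice `𝔨_s` of the Lie algebra, where `c = ⌈s⌉`. -/
def kfrakC (S : USetting E) (c : ℤ) : Set (Mat E) :=
  {Y | Y ∈ gfrak S ∧ (c : WithTop ℤ) ≤ S.nu (Y 0 0) ∧ (c : WithTop ℤ) ≤ S.nu (Y 1 1) ∧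
    (∃ t, S.sig t = t ∧ (c : WithTop ℤ) ≤ S.nu t ∧ Y 0 1 = S.sqeps * t) ∧
    (∃ t, S.sig t = t ∧ (c : WithTop ℤ) ≤ S.nu t ∧ Y 1 0 = S.sqeps * t)}

/-- The group `J_d`. -/
def Jgrp (S : USetting E) (d : ℕ) : Set (Mat E) :=
  {g | g ∈ Kset S ∧ ((((d + 1) / 2 : ℕ) : WithTop ℤ) ≤ S.nu (g 0 0 - 1)) ∧
    ((((d + 1) / 2 : ℕ) : WithTop ℤ) ≤ S.nu (g 0 1)) ∧
    ((((d + 1) / 2 : ℕ) : WithTop ℤ) ≤ S.nu (g 1 1 - 1)) ∧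
    (((d / 2 + 1 : ℕ) : WithTop ℤ) ≤ S.nu (g 1 0))}

/-- The centralizer `T(X)` in `K` of `X = [[z√ε, u√ε],[v√ε, z√ε]]`. -/
def TXset (S : USetting E) (u v : E) : Set (Mat E) :=
  {m | m ∈ Kset S ∧ m 1 1 = m 0 0 ∧ m 1 0 = m 0 1 * (u⁻¹ * v)}

/-- The center `Z` of `G`, identified with scalar matrices with entries in `E^1`. -/
def Zset (S : USetting E) : Set (Mat E) := {m | ∃ z ∈ E1set S, m = z • (1 : Mat E)}

/-- `𝒰 = U ∩ K`. -/
def Uset (S : USetting E) : Set (Mat E) :=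
  {m | ∃ b, S.sig b = b ∧ 0 ≤ S.nu b ∧ m = !![1, b * S.sqeps; 0, 1]}

/-- The set of products `T(X)·J_d`. -/
def TXJ (S : USetting E) (u v : E) (d : ℕ) : Set (Mat E) :=
  {x | ∃ t ∈ TXset S u v, ∃ j ∈ Jgrp S d, x = t * j}

/-- The set of products `Z·𝒰·J_d`. -/
def ZUJ (S : USetting E) (d : ℕ) : Set (Mat E) :=
  {x | ∃ z ∈ Zset S, ∃ m ∈ Uset S, ∃ j ∈ Jgrp S d, x = z * m * j}

/-- `X = [[z√ε, u√ε],[v√ε, z√ε]]`. -/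
def Xzuv (S : USetting E) (z u v : E) : Mat E :=
  !![z * S.sqeps, u * S.sqeps; v * S.sqeps, z * S.sqeps]

/-- The nilpotent element `X_δ = [[0, δ√ε],[0,0]]`. -/
def Xdelta (S : USetting E) (δ : E) : Mat E := !![0, δ * S.sqeps; 0, 0]

/-- `W` is a `K`-invariant complement of `V_χ^{K_d}` inside `V_χ^{K_{d+1}}`. -/
def Wcompl (S : USetting E) (χ : E → ℂ) (d : ℕ) (W : Submodule ℂ (Mat E → ℂ)) : Prop :=
  W ≤ Vsp S χ ((d : ℤ) + 1) ∧ KInvariant S W ∧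
    Vsp S χ (d : ℤ) ⊓ W = ⊥ ∧ Vsp S χ (d : ℤ) ⊔ W = Vsp S χ ((d : ℤ) + 1)

namespace USetting

variable (S : USetting E)

/-- `x` lies in the fractional ideal `p_E^n`. -/
def InIdeal (n : ℤ) (x : E) : Prop := (n : WithTop ℤ) ≤ S.nu x

variable {S}

theorem nu_one : S.nu 1 = 0 := by
  have h := S.nu_mul 1 1
  have h1 : S.nu 1 ≠ ⊤ := fun h => one_ne_zero ((S.nu_eq_top 1).1 h)
  obtain ⟨a, ha⟩ := WithTop.ne_top_iff_exists.1 h1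
  rw [mul_one, ← ha] at h
  rw [← ha]
  norm_cast at h ⊢
  omega

theorem nu_neg (x : E) : S.nu (-x) = S.nu x := by
  have h := S.nu_mul (-1) (-1)
  have h1 : S.nu (-1) ≠ ⊤ := fun h => neg_ne_zero.2 one_ne_zero ((S.nu_eq_top (-1)).1 h)
  have h2 : S.nu (-1) = 0 := by
    rw [neg_mul_neg, mul_one, nu_one] at h
    lift S.nu (-1) to ℤ using h1 with a
    norm_cast at h ⊢
    omega
  rw [neg_eq_neg_one_mul, S.nu_mul, h2, zero_add]

theorem nu_inv_of_nu_zero {x : E} (h : S.nu x = 0) : S.nu x⁻¹ = 0 := by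
  have hx : x ≠ 0 := fun h0 => by simp [(S.nu_eq_top x).2 h0] at h
  have := S.nu_mul x x⁻¹
  rw [mul_inv_cancel₀ hx, nu_one, h, zero_add] at this
  exact this.symm

namespace InIdeal

variable {m n : ℤ} {x y : E}

theorem mono (h : S.InIdeal n x) (hmn : m ≤ n) : S.InIdeal m x :=
  le_trans (by exact_mod_cast hmn) h

theorem zero : S.InIdeal n 0 := by
  simp [InIdeal, (S.nu_eq_top 0).2 rfl]

theorem add (hx : S.InIdeal n x) (hy : S.InIdeal n y) : S.InIdeal n (x + y) :=
  le_trans (le_min hx hy) (S.nu_add x y)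

theorem neg (hx : S.InIdeal n x) : S.InIdeal n (-x) := by
  rwa [InIdeal, nu_neg]

theorem sub (hx : S.InIdeal n x) (hy : S.InIdeal n y) : S.InIdeal n (x - y) :=
  sub_eq_add_neg x y ▸ hx.add hy.neg

theorem mul (hx : S.InIdeal m x) (hy : S.InIdeal n y) : S.InIdeal (m + n) (x * y) := by
  rw [InIdeal, S.nu_mul, WithTop.coe_add]
  exact add_le_add hx hy

theorem sig (hx : S.InIdeal n x) : S.InIdeal n (S.sig x) := by
  rwa [InIdeal, S.nu_sig]

theorem of_mul_unit_left (hx : S.nu x = 0) (h : S.InIdeal n (x * y)) : S.InIdeal n y := by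
  rwa [InIdeal, S.nu_mul, hx, zero_add] at h

theorem half (hx : S.InIdeal n x) : S.InIdeal n (x / 2) := by
  rw [InIdeal, div_eq_mul_inv, S.nu_mul, nu_inv_of_nu_zero S.nu_two, add_zero]
  exact hx

/-- An element divisible by every power of the uniformizer vanishes. -/
theorem eq_zero (h : ∀ k : ℕ, S.InIdeal k x) : x = 0 := by
  by_contra hx
  have h1 : S.nu x ≠ ⊤ := fun h => hx ((S.nu_eq_top x).1 h)
  obtain ⟨a, ha⟩ := WithTop.ne_top_iff_exists.1 h1
  have := h (a.toNat + 1)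
  rw [InIdeal, ← ha] at this
  have := WithTop.coe_le_coe.1 this
  push_cast at this
  have := Int.self_le_toNat a
  omega

theorem mul_left (hx : S.InIdeal 0 x) (hy : S.InIdeal n y) : S.InIdeal n (x * y) :=
  zero_add n ▸ hx.mul hy

theorem mul_right (hx : S.InIdeal n x) (hy : S.InIdeal 0 y) : S.InIdeal n (x * y) :=
  add_zero n ▸ hx.mul hy

end InIdeal

theorem inIdeal_zero_of_nu_zero {x : E} (h : S.nu x = 0) : S.InIdeal 0 x := h.ge

theorem ne_zero_of_nu_zero {x : E} (h : S.nu x = 0) : x ≠ 0 := by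
  rintro rfl
  simp [(S.nu_eq_top 0).2 rfl] at h

theorem field_two_ne_zero (S : USetting E) : (2 : E) ≠ 0 := ne_zero_of_nu_zero S.nu_two

/-- Elements congruent to `1` modulo `p_E` are units. -/
theorem nu_eq_zero_of_sub_one {x : E} (h : S.InIdeal 1 (x - 1)) : S.nu x = 0 := by
  have h0 : S.InIdeal 0 x := by
    simpa using (h.mono zero_le_one).add (inIdeal_zero_of_nu_zero (nu_one (S := S)))
  refine le_antisymm ?_ h0
  by_contra hlt
  have h1 : S.InIdeal 1 x := by
    rw [InIdeal]
    cases hx : S.nu x with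
    | top => exact le_top
    | coe a =>
      rw [hx] at hlt
      norm_cast at hlt ⊢
      omega
  have h2 := h1.sub h
  rw [sub_sub_cancel, InIdeal, nu_one] at h2
  norm_cast at h2

/-- A factor of a unit among integers is a unit. -/
theorem nu_eq_zero_of_mul {x y : E} (hx : S.InIdeal 0 x) (hy : S.InIdeal 0 y)
    (h : S.nu (x * y) = 0) : S.nu x = 0 := by
  rw [S.nu_mul] at h
  rw [InIdeal] at hx hy
  cases hx' : S.nu x with
  | top => simp [hx'] at h
  | coe a =>
    cases hy' : S.nu y with
    | top => simp [hy'] at h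
    | coe b =>
      rw [hx'] at h hx
      rw [hy'] at h hy
      norm_cast at *
      omega

/-- If `x` is congruent modulo `p_E^n` to its multiple by an element of `p_E`, then `x ∈ p_E^n`. -/
theorem inIdeal_of_contraction {n : ℤ} {x w : E} (hw : S.InIdeal 1 w)
    (h : S.InIdeal n (x - w * x)) : S.InIdeal n x := by
  by_contra hn
  rw [InIdeal] at hn
  cases hx : S.nu x with
  | top => simp [hx] at hn
  | coe a =>
    rw [hx] at hn
    have h1 : S.InIdeal (1 + a) (w * x) := hw.mul hx.ge
    have han : a < n := by norm_cast at hn; omega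
    have h2 := (h.mono (show a + 1 ≤ n by omega)).add (h1.mono (show a + 1 ≤ 1 + a by omega))
    rw [sub_add_cancel, InIdeal, hx] at h2
    norm_cast at h2
    omega

/-- Square roots exist in `1 + p_E^n`. -/
theorem exists_sq_eq {n : ℕ} (hn : 1 ≤ n) {A : E} (hA : S.InIdeal n (A - 1)) :
    ∃ L, L * L = A ∧ S.InIdeal n (L - 1) := by
  let f : ℕ → E := fun k => Nat.rec 1 (fun _ x => x - (x * x - A) / 2) k
  have hf : ∀ k, f (k + 1) = f k - (f k * f k - A) / 2 := fun k => rfl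
  have inv : ∀ k : ℕ, S.InIdeal n (f k - 1) ∧ S.InIdeal (n + k) (f k * f k - A) := by
    intro k
    induction k with
    | zero =>
      refine ⟨by simpa [f] using InIdeal.zero, ?_⟩
      simpa [f] using hA.neg
    | succ k ih =>
      obtain ⟨h1, h2⟩ := ih
      refine ⟨?_, ?_⟩
      · rw [hf, sub_right_comm]
        exact h1.sub (h2.half.mono (by omega))
      · have e : f (k + 1) * f (k + 1) - A
            = (f k * f k - A) / 2 * ((f k * f k - A) / 2) - (f k * f k - A) * (f k - 1) := by
          have := field_two_ne_zero S
          rw [hf]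
          field_simp
          ring
        rw [e]
        push_cast
        exact ((h2.half.mul h2.half).mono (by omega)).sub ((h2.mul h1).mono (by omega))
  obtain ⟨L, hL⟩ := S.complete f fun k => by
    have := ((inv k).2.half.neg).mono (show (k : ℤ) ≤ n + k by omega)
    rw [hf, sub_sub_cancel_left]
    exact this
  have hL' : ∀ k : ℕ, S.InIdeal k (L - f k) := hL
  have hL1 : S.InIdeal n (L - 1) := by
    simpa using (hL' n).add (inv n).1
  refine ⟨L, sub_eq_zero.1 (InIdeal.eq_zero (S := S) fun k => ?_), hL1⟩
  have one0 : S.InIdeal 0 1 := inIdeal_zero_of_nu_zero nu_one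
  have hL0 : S.InIdeal 0 L := by simpa using (hL1.mono (by omega)).add one0
  have hf0 : S.InIdeal 0 (f k) := by simpa using ((inv k).1.mono (by omega)).add one0
  have e : L * L - A = (L - f k) * (L + f k) + (f k * f k - A) := by ring
  rw [e]
  exact ((hL' k).mul_right (hL0.add hf0)).add ((inv k).2.mono (by omega))

/-- Square roots of elements of `1 + p_F^n` exist in `1 + p_F^n`. -/
theorem exists_sq_eq_of_fixed {n : ℕ} (hn : 1 ≤ n) {A : E} (hA : S.InIdeal n (A - 1))
    (hfix : S.sig A = A) : ∃ L, S.sig L = L ∧ L * L = A ∧ S.InIdeal n (L - 1) := by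
  obtain ⟨L, hLA, hL⟩ := exists_sq_eq hn hA
  refine ⟨L, ?_, hLA, hL⟩
  have h1 : S.sig L * S.sig L = L * L := by rw [← map_mul, hLA, hfix]
  rcases mul_self_eq_mul_self_iff.1 h1 with h | h
  · exact h
  · have h2 := hL.sig.add hL
    rw [map_sub, map_one, h, show -L - 1 + (L - 1) = -2 by ring, InIdeal, nu_neg, S.nu_two] at h2
    norm_cast at h2
    omega

theorem psiE_add (x y : E) : psiE S (x + y) = psiE S x * psiE S y := by
  have hfix : ∀ x, S.sig ((x + S.sig x) / 2) = (x + S.sig x) / 2 := fun x => by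
    rw [map_div₀, map_add, S.sig_invol, map_ofNat, add_comm]
  rw [psiE, psiE, psiE, ← S.psi'_mul _ _ (hfix x) (hfix y), map_add]
  congr 1
  ring

theorem psiE_ne_zero (x : E) : psiE S x ≠ 0 :=
  S.psi'_ne _ (by rw [map_div₀, map_add, S.sig_invol, map_ofNat, add_comm])

theorem psiE_eq_one {x : E} (h : S.InIdeal 1 x) : psiE S x = 1 :=
  S.psi'_triv _ (by rw [map_div₀, map_add, S.sig_invol, map_ofNat, add_comm])
    (h.add h.sig).half

theorem psiE_of_fixed {x : E} (h : S.sig x = x) : psiE S x = S.psi' x := by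
  have := field_two_ne_zero S
  rw [psiE, h]
  congr 1
  field_simp
  ring

/-- The orthogonal of `p_F^m` under `ψ'` is `p_F^{1-m}`. -/
theorem inIdeal_of_psiE_mul_eq_one {m : ℤ} {y : E} (hy : S.sig y = y)
    (h : ∀ b, S.sig b = b → S.InIdeal m b → psiE S (y * b) = 1) : S.InIdeal (1 - m) y := by
  by_contra hlt
  obtain ⟨x, hx, hx0, hx1⟩ := S.psi'_nontriv
  have hy0 : y ≠ 0 := by rintro rfl; exact hlt InIdeal.zero
  have e : y * (x / y) = x := by field_simp
  refine hx1 ?_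
  rw [← psiE_of_fixed hx, ← e]
  refine h _ (by rw [map_div₀, hx, hy]) ?_
  rw [← e, S.nu_mul] at hx0
  rw [InIdeal] at hlt ⊢
  cases hb : S.nu (x / y) with
  | top => exact le_top
  | coe b =>
    cases ha : S.nu y with
    | top => simp [ha] at hlt
    | coe a =>
      rw [ha] at hlt hx0
      rw [hb] at hx0
      norm_cast at *
      omega

/-- The matrix `M` has all entries in `p_E^n`. -/
def MatInIdeal (S : USetting E) (n : ℤ) (M : Mat E) : Prop := ∀ i j, S.InIdeal n (M i j)

namespace MatInIdeal

variable {m n : ℤ} {A B : Mat E}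

theorem mul (hA : S.MatInIdeal m A) (hB : S.MatInIdeal n B) : S.MatInIdeal (m + n) (A * B) := by
  intro i j
  rw [Matrix.mul_apply, Fin.sum_univ_two]
  exact ((hA _ _).mul (hB _ _)).add ((hA _ _).mul (hB _ _))

theorem sub (hA : S.MatInIdeal n A) (hB : S.MatInIdeal n B) : S.MatInIdeal n (A - B) :=
  fun i j => (hA i j).sub (hB i j)

theorem trace (hA : S.MatInIdeal n A) : S.InIdeal n A.trace := by
  rw [Matrix.trace_fin_two]
  exact (hA _ _).add (hA _ _)

theorem mono (hA : S.MatInIdeal n A) (h : m ≤ n) : S.MatInIdeal m A :=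
  fun i j => (hA i j).mono h

end MatInIdeal

/-- The entrywise description of `G`. -/
theorem mem_Gset_iff {k : Mat E} : k ∈ Gset S ↔
    S.sig (k 1 0) * k 0 0 + S.sig (k 0 0) * k 1 0 = 0 ∧
    S.sig (k 1 0) * k 0 1 + S.sig (k 0 0) * k 1 1 = 1 ∧
    S.sig (k 1 1) * k 0 0 + S.sig (k 0 1) * k 1 0 = 1 ∧
    S.sig (k 1 1) * k 0 1 + S.sig (k 0 1) * k 1 1 = 0 := by
  change (k.map S.sig)ᵀ * w0 E * k = w0 E ↔ _
  rw [← Matrix.ext_iff]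
  simp [Fin.forall_fin_two, Matrix.mul_apply, Fin.sum_univ_two, w0, and_assoc]

/-- The inverse of `k ∈ G` is its adjoint for the Hermitian form. -/
theorem inv_eq_of_mem_Gset {k : Mat E} (hk : k ∈ Gset S) :
    k⁻¹ = !![S.sig (k 1 1), S.sig (k 0 1); S.sig (k 1 0), S.sig (k 0 0)] := by
  obtain ⟨h1, h2, h3, h4⟩ := mem_Gset_iff.1 hk
  refine Matrix.inv_eq_left_inv ?_
  ext i j
  fin_cases i <;> fin_cases j <;> simp [Matrix.mul_apply, Fin.sum_univ_two, h1, h2, h3, h4]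

/-- Unitary matrices have determinant of norm one, hence a unit. -/
theorem nu_det_of_mem_Gset {k : Mat E} (hk : k ∈ Gset S) : S.nu k.det = 0 := by
  obtain ⟨h1, h2, h3, h4⟩ := mem_Gset_iff.1 hk
  have h : S.sig k.det * k.det = 1 := by
    rw [Matrix.det_fin_two, map_sub, map_mul, map_mul]
    linear_combination (S.sig (k 1 1) * k 0 0 + S.sig (k 0 1) * k 1 0) * h2 + h3
      - (S.sig (k 1 1) * k 0 1 + S.sig (k 0 1) * k 1 1) * h1
  have h5 := S.nu_mul (S.sig k.det) k.det
  rw [h, nu_one, S.nu_sig] at h5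
  cases hx : S.nu k.det with
  | top => simp [hx] at h5
  | coe a =>
    rw [hx] at h5
    norm_cast at *
    omega

theorem isUnit_det_of_mem_Kset {k : Mat E} (hk : k ∈ Kset S) : IsUnit k.det :=
  (ne_zero_of_nu_zero hk.2.2).isUnit

theorem matInIdeal_zero_of_mem_Kset {k : Mat E} (hk : k ∈ Kset S) : S.MatInIdeal 0 k :=
  hk.2.1

theorem matInIdeal_inv_of_mem_Kset {k : Mat E} (hk : k ∈ Kset S) : S.MatInIdeal 0 k⁻¹ := by
  have h := matInIdeal_zero_of_mem_Kset hk
  rw [inv_eq_of_mem_Gset hk.1]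
  intro i j
  fin_cases i <;> fin_cases j <;> exact (h _ _).sig

theorem mul_mem_Kset {k l : Mat E} (hk : k ∈ Kset S) (hl : l ∈ Kset S) : k * l ∈ Kset S := by
  refine ⟨?_, (matInIdeal_zero_of_mem_Kset hk).mul (matInIdeal_zero_of_mem_Kset hl), ?_⟩
  · have hk1 : (k.map S.sig)ᵀ * w0 E * k = w0 E := hk.1
    have hl1 : (l.map S.sig)ᵀ * w0 E * l = w0 E := hl.1
    change ((k * l).map S.sig)ᵀ * w0 E * (k * l) = w0 E
    rw [Matrix.map_mul, Matrix.transpose_mul]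
    calc _ = (l.map S.sig)ᵀ * ((k.map S.sig)ᵀ * w0 E * k) * l := by simp only [Matrix.mul_assoc]
      _ = w0 E := by rw [hk1, hl1]
  · rw [Matrix.det_mul, S.nu_mul, hk.2.2, hl.2.2, add_zero]

theorem inv_mem_Kset {k : Mat E} (hk : k ∈ Kset S) : k⁻¹ ∈ Kset S := by
  have hu := isUnit_det_of_mem_Kset hk
  refine ⟨?_, matInIdeal_inv_of_mem_Kset hk, ?_⟩
  · have hk1 : (k.map S.sig)ᵀ * w0 E * k = w0 E := hk.1
    have hs : (k⁻¹.map S.sig)ᵀ * (k.map S.sig)ᵀ = 1 := by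
      rw [← Matrix.transpose_mul, ← Matrix.map_mul, Matrix.mul_nonsing_inv k hu]
      simp
    change (k⁻¹.map S.sig)ᵀ * w0 E * k⁻¹ = w0 E
    calc _ = (k⁻¹.map S.sig)ᵀ * ((k.map S.sig)ᵀ * w0 E * k) * k⁻¹ := by rw [hk1]
      _ = ((k⁻¹.map S.sig)ᵀ * (k.map S.sig)ᵀ) * w0 E * (k * k⁻¹) := by
        simp only [Matrix.mul_assoc]
      _ = w0 E := by rw [hs, Matrix.mul_nonsing_inv k hu, Matrix.one_mul, Matrix.mul_one]
  · rw [Matrix.det_nonsing_inv, Ring.inverse_eq_inv', nu_inv_of_nu_zero hk.2.2]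

/-- `k` stabilizes `Ψ_X` at `g` exactly when `ψ` kills the pairing of `k⁻¹Xk - X` with `g - 1`. -/
theorem PsiC_conj_eq_iff {k : Mat E} (hk : k ∈ Kset S) (X g : Mat E) :
    PsiC S X (k * g * k⁻¹) = PsiC S X g ↔
      psiE S ((k⁻¹ * X * k - X) * (g - 1)).trace = 1 := by
  have hu := isUnit_det_of_mem_Kset hk
  have e : (X * (k * g * k⁻¹ - 1)).trace
      = ((k⁻¹ * X * k - X) * (g - 1)).trace + (X * (g - 1)).trace := by
    have e1 : k * g * k⁻¹ - 1 = k * (g - 1) * k⁻¹ := by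
      rw [Matrix.mul_sub, Matrix.sub_mul, Matrix.mul_one, Matrix.mul_nonsing_inv k hu]
    rw [e1, ← Matrix.trace_add, ← Matrix.add_mul, sub_add_cancel, ← Matrix.mul_assoc,
      Matrix.trace_mul_comm]
    simp only [Matrix.mul_assoc]
  rw [PsiC, PsiC, e, psiE_add]
  exact mul_eq_right₀ (psiE_ne_zero _)

theorem matInIdeal_Xzuv {n : ℤ} {z u v : E} (hz : S.InIdeal n z) (hu : S.InIdeal n u)
    (hv : S.InIdeal n v) : S.MatInIdeal n (Xzuv S z u v) := by
  have hs := inIdeal_zero_of_nu_zero S.nu_sqeps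
  intro i j
  fin_cases i <;> fin_cases j
  exacts [hz.mul_right hs, hu.mul_right hs, hv.mul_right hs, hz.mul_right hs]

theorem commute_Xzuv_of_mem_TXset {z u v : E} (hu : u ≠ 0) {t : Mat E} (ht : t ∈ TXset S u v) :
    Xzuv S z u v * t = t * Xzuv S z u v := by
  obtain ⟨-, h1, h2⟩ := ht
  ext i j
  fin_cases i <;> fin_cases j <;>
    simp [Xzuv, Matrix.mul_apply, Fin.sum_univ_two, h1, h2] <;> field_simp <;> ring


theorem lower_mem_Kfil {m : ℤ} (hm : 0 ≤ m) {b : E} (hb : S.sig b = b) (hbm : S.InIdeal m b) :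
    !![1, 0; b * S.sqeps, 1] ∈ Kfil S m := by
  have hs := inIdeal_zero_of_nu_zero S.nu_sqeps
  have one0 : S.InIdeal 0 1 := inIdeal_zero_of_nu_zero nu_one
  have hbs := hbm.mul_right hs
  refine ⟨⟨mem_Gset_iff.2 ?_, ?_, ?_⟩, ?_⟩
  · simp [S.sig_sqeps, hb]
  · change S.MatInIdeal 0 _
    intro i j
    fin_cases i <;> fin_cases j
    exacts [one0, InIdeal.zero, hbs.mono hm, one0]
  · simp [Matrix.det_fin_two, nu_one]
  · change S.MatInIdeal m _
    intro i j
    fin_cases i <;> fin_cases j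
    · simpa using InIdeal.zero
    · simpa using InIdeal.zero
    · simpa using hbs
    · simpa using InIdeal.zero

theorem diag_mem_Kfil {m : ℤ} (hm : 1 ≤ m) {t : E} (ht : S.sig t = t) (htm : S.InIdeal m t) :
    !![1 + t, 0; 0, (1 + t)⁻¹] ∈ Kfil S m := by
  have hu : S.nu (1 + t) = 0 := nu_eq_zero_of_sub_one (by simpa using htm.mono hm)
  have h0 : 1 + t ≠ 0 := ne_zero_of_nu_zero hu
  have hi := inIdeal_zero_of_nu_zero (nu_inv_of_nu_zero hu)
  refine ⟨⟨mem_Gset_iff.2 ?_, ?_, ?_⟩, ?_⟩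
  · simp [ht, h0]
  · change S.MatInIdeal 0 _
    intro i j
    fin_cases i <;> fin_cases j
    exacts [inIdeal_zero_of_nu_zero hu, InIdeal.zero, InIdeal.zero, hi]
  · simp [Matrix.det_fin_two, h0, nu_one]
  · change S.MatInIdeal m _
    intro i j
    fin_cases i <;> fin_cases j
    · simpa using htm
    · simpa using InIdeal.zero
    · simpa using InIdeal.zero
    · have e : (1 + t)⁻¹ - 1 = -(t * (1 + t)⁻¹) := by field_simp; ring
      simpa [e] using (htm.mul_right hi).neg

/-- If `ψ(Tr(Y(g - 1)))` is trivial on `K_m`, the upper right entry of `Y` lies in `p_E^{1-m}`. -/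
theorem inIdeal_upper_of_trivial {m : ℤ} (hm : 0 ≤ m) {Y : Mat E}
    (h : ∀ g ∈ Kfil S m, psiE S (Y * (g - 1)).trace = 1) {y : E} (hy : S.sig y = y)
    (hY : Y 0 1 = S.sqeps * y) : S.InIdeal (1 - m) y := by
  have key : S.InIdeal (1 - m) (S.sqeps * S.sqeps * y) := by
    refine inIdeal_of_psiE_mul_eq_one (by simp [S.sig_sqeps, hy]) fun b hb hbm => ?_
    rw [← h _ (lower_mem_Kfil hm hb hbm)]
    congr 1
    simp [Matrix.trace_fin_two, Matrix.mul_apply, Fin.sum_univ_two, hY]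
    ring
  exact key.of_mul_unit_left (by simp [S.nu_mul, S.nu_sqeps])

/-- If `ψ(Tr(Y(g - 1)))` is trivial on `K_m`, the diagonal of a trace-zero `Y` with entries in `F`
on the diagonal and of bounded denominator lies in `p_E^{1-m}`. -/
theorem inIdeal_diag_of_trivial {m : ℤ} (hm : 1 ≤ m) {Y : Mat E}
    (h : ∀ g ∈ Kfil S m, psiE S (Y * (g - 1)).trace = 1) (hfix : S.sig (Y 0 0) = Y 0 0)
    (htr : Y 1 1 = -Y 0 0) (hY : S.InIdeal (1 - 2 * m) (Y 0 0)) : S.InIdeal (1 - m) (Y 0 0) := by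
  have key : S.InIdeal (1 - m) (2 * Y 0 0) := by
    refine inIdeal_of_psiE_mul_eq_one (by rw [map_mul, map_ofNat, hfix]) fun t ht htm => ?_
    have hu : S.nu (1 + t) = 0 := nu_eq_zero_of_sub_one (by simpa using htm.mono hm)
    have h0 : 1 + t ≠ 0 := ne_zero_of_nu_zero hu
    have hi := inIdeal_zero_of_nu_zero (nu_inv_of_nu_zero hu)
    have h1 := h _ (diag_mem_Kfil hm ht htm)
    have e : (Y * (!![1 + t, 0; 0, (1 + t)⁻¹] - 1)).trace
        = 2 * Y 0 0 * t + -(Y 0 0 * (t * (t * (1 + t)⁻¹))) := by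
      simp [Matrix.trace_fin_two, Matrix.mul_apply, Fin.sum_univ_two, htr]
      field_simp
      ring
    have h2 : S.InIdeal 1 (-(Y 0 0 * (t * (t * (1 + t)⁻¹)))) :=
      ((hY.mul (htm.mul (htm.mul_right hi))).mono (by omega)).neg
    rwa [e, psiE_add, psiE_eq_one h2, mul_one] at h1
  exact key.of_mul_unit_left S.nu_two

/-- The congruences satisfied by an element of `K` stabilizing `Ψ_X` on `K_m`, in terms of
`w = v / u`. -/
theorem congruences_of_stabilizes {m n d : ℤ} (hm : 1 ≤ m) (hmn : m + n = d + 1)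
    (hdm : d + 1 ≤ 2 * m) {z u w : E} (hu : S.sig u = u) (hw : S.sig w = w)
    (hnu : S.nu u = ((-d : ℤ) : WithTop ℤ)) (hw0 : S.InIdeal 0 w) {k : Mat E} (hk : k ∈ Kset S)
    (h : ∀ g ∈ Kfil S m,
      psiE S ((k⁻¹ * Xzuv S z u (u * w) * k - Xzuv S z u (u * w)) * (g - 1)).trace = 1) :
    S.InIdeal n (S.sig (k 1 1) * k 1 1 + w * (S.sig (k 0 1) * k 0 1) - 1) ∧
    S.InIdeal n (S.sig (k 1 1) * k 1 0 + w * (S.sig (k 0 1) * k 0 0)) := by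
  have hinv := inv_eq_of_mem_Gset hk.1
  obtain ⟨-, g2, g3, g4⟩ := mem_Gset_iff.1 hk.1
  have gi := mem_Gset_iff.1 (inv_mem_Kset hk).1
  rw [hinv] at gi
  simp only [Matrix.of_apply, Matrix.cons_val', Matrix.cons_val_zero, Matrix.cons_val_one,
    Matrix.cons_val_fin_one, S.sig_invol] at gi
  obtain ⟨i1, -, -, i4⟩ := gi
  have hk0 := matInIdeal_zero_of_mem_Kset hk
  have hs := inIdeal_zero_of_nu_zero S.nu_sqeps
  have hud : S.InIdeal (-d) u := hnu.ge
  have descend : ∀ x, S.InIdeal (1 - m) (u * x) → S.InIdeal n x := by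
    intro x hx
    rw [InIdeal, S.nu_mul, hnu] at hx
    rw [InIdeal]
    cases hx' : S.nu x with
    | top => exact le_top
    | coe a =>
      rw [hx'] at hx
      norm_cast at *
      omega
  set Y := k⁻¹ * Xzuv S z u (u * w) * k - Xzuv S z u (u * w) with hYdef
  have Y01 : Y 0 1 = S.sqeps *
      (u * (S.sig (k 1 1) * k 1 1 + w * (S.sig (k 0 1) * k 0 1) - 1)) := by
    rw [hYdef, hinv, Matrix.sub_apply, Matrix.mul_apply, Fin.sum_univ_two]
    simp [Xzuv]
    linear_combination z * S.sqeps * g4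
  have Y00 : Y 0 0 = S.sqeps *
      (u * (S.sig (k 1 1) * k 1 0 + w * (S.sig (k 0 1) * k 0 0))) := by
    rw [hYdef, hinv, Matrix.sub_apply, Matrix.mul_apply, Fin.sum_univ_two]
    simp [Xzuv]
    linear_combination z * S.sqeps * g3
  have Y11 : Y 1 1 = -Y 0 0 := by
    rw [Y00, hYdef, hinv, Matrix.sub_apply, Matrix.mul_apply, Fin.sum_univ_two]
    simp [Xzuv]
    linear_combination z * S.sqeps * g2 + u * S.sqeps * i1 + u * w * S.sqeps * i4
  refine ⟨descend _ (inIdeal_upper_of_trivial (by omega) h ?_ Y01), descend _ ?_⟩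
  · simp only [map_mul, map_sub, map_add, map_one, S.sig_invol, hu, hw]
    ring
  · have hY : S.InIdeal (1 - m) (Y 0 0) := by
      refine inIdeal_diag_of_trivial hm h ?_ Y11 ?_
      · rw [Y00]
        simp only [map_mul, map_add, S.sig_invol, hu, hw, S.sig_sqeps]
        linear_combination -(u * S.sqeps) * i1 - u * w * S.sqeps * i4
      · rw [Y00]
        refine (hs.mul_left (hud.mul_right ?_)).mono (by omega)
        exact ((hk0 _ _).sig.mul_left (hk0 _ _)).add
          (hw0.mul_left ((hk0 _ _).sig.mul_left (hk0 _ _)))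
    rw [Y00] at hY
    exact hY.of_mul_unit_left S.nu_sqeps

/-- An element of `K` satisfying the stabilizer congruences has the shape
`[[a, b], [w b, a]]` modulo `p_E^n`. -/
theorem approx_centralizer {n : ℤ} (hn : 1 ≤ n) {w : E} (hw1 : S.InIdeal 1 w) {k : Mat E}
    (hk : k ∈ Kset S)
    (h1 : S.InIdeal n (S.sig (k 1 1) * k 1 1 + w * (S.sig (k 0 1) * k 0 1) - 1))
    (h3 : S.InIdeal n (S.sig (k 1 1) * k 1 0 + w * (S.sig (k 0 1) * k 0 0))) :
    S.nu (k 1 1) = 0 ∧ S.InIdeal n (k 0 0 - k 1 1) ∧ S.InIdeal n (k 1 0 - w * k 0 1) := by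
  obtain ⟨-, -, g3, g4⟩ := mem_Gset_iff.1 hk.1
  have hk0 := matInIdeal_zero_of_mem_Kset hk
  have hd : S.nu (k 1 1) = 0 := by
    have hb : S.InIdeal 1 (w * (S.sig (k 0 1) * k 0 1)) :=
      hw1.mul_right ((hk0 _ _).sig.mul_left (hk0 _ _))
    have h := (h1.mono hn).sub hb
    rw [show ∀ x y : E, x + y - 1 - y = x - 1 from fun x y => by ring, mul_comm] at h
    exact nu_eq_zero_of_mul (hk0 _ _) (hk0 _ _).sig (nu_eq_zero_of_sub_one h)
  have hd' : S.nu (S.sig (k 1 1)) = 0 := by rw [S.nu_sig, hd]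
  have hne := ne_zero_of_nu_zero hd'
  have hi := inIdeal_zero_of_nu_zero (nu_inv_of_nu_zero hd')
  have hdelta : S.InIdeal n (k 0 0 - k 1 1) := by
    set r := S.sig (k 0 1) * (S.sig (k 1 1))⁻¹ with hr
    have hr0 : S.InIdeal 0 r := (hk0 _ _).sig.mul_left hi
    refine inIdeal_of_contraction (hw1.mul_right (hr0.mul_left hr0)) (w := w * (r * r)) ?_
    refine InIdeal.of_mul_unit_left (x := S.sig (k 1 1) * S.sig (k 1 1))
      (by rw [S.nu_mul, hd', add_zero]) ?_
    have e : S.sig (k 1 1) * S.sig (k 1 1) * (k 0 0 - k 1 1 - w * (r * r) * (k 0 0 - k 1 1))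
        = -(S.sig (k 1 1) * (S.sig (k 1 1) * k 1 1 + w * (S.sig (k 0 1) * k 0 1) - 1))
          - S.sig (k 0 1) * (S.sig (k 1 1) * k 1 0 + w * (S.sig (k 0 1) * k 0 0)) := by
      rw [hr]
      field_simp
      linear_combination S.sig (k 1 1) * g3 + w * S.sig (k 0 1) * g4
    rw [e]
    exact (((hk0 _ _).sig.mul_left h1).neg).sub ((hk0 _ _).sig.mul_left h3)
  refine ⟨hd, hdelta, InIdeal.of_mul_unit_left hd' ?_⟩
  have e : S.sig (k 1 1) * (k 1 0 - w * k 0 1)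
      = (S.sig (k 1 1) * k 1 0 + w * (S.sig (k 0 1) * k 0 0))
        - w * S.sig (k 0 1) * (k 0 0 - k 1 1) := by
    linear_combination -w * g4
  rw [e]
  exact h3.sub (((hw1.mono zero_le_one).mul_left (hk0 _ _).sig).mul_left hdelta)

/-- An element of `K` satisfying the stabilizer congruences is congruent to a unitary
matrix of the shape `[[a, b], [w b, a]]`. -/
theorem exists_centralizer_congr {n : ℕ} (hn : 1 ≤ n) {w : E} (hw : S.sig w = w)
    (hw1 : S.InIdeal 1 w) {k : Mat E} (hk : k ∈ Kset S)
    (h1 : S.InIdeal n (S.sig (k 1 1) * k 1 1 + w * (S.sig (k 0 1) * k 0 1) - 1))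
    (h3 : S.InIdeal n (S.sig (k 1 1) * k 1 0 + w * (S.sig (k 0 1) * k 0 0))) :
    ∃ t ∈ Kset S, t 1 1 = t 0 0 ∧ t 1 0 = t 0 1 * w ∧ S.MatInIdeal n (k - t) := by
  obtain ⟨hd, hdelta, hgamma⟩ := approx_centralizer (by exact_mod_cast hn) hw1 hk h1 h3
  obtain ⟨-, -, -, g4⟩ := mem_Gset_iff.1 hk.1
  have hk0 := matInIdeal_zero_of_mem_Kset hk
  set A := S.sig (k 1 1) * k 1 1 + w * (S.sig (k 0 1) * k 0 1) with hA
  have hA0 : S.nu A = 0 := nu_eq_zero_of_sub_one (h1.mono (by exact_mod_cast hn))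
  have hAne := ne_zero_of_nu_zero hA0
  have hAfix : S.sig A = A := by
    simp only [hA, map_add, map_mul, S.sig_invol, hw]
    ring
  obtain ⟨L, hLfix, hLA, hL⟩ := exists_sq_eq_of_fixed (A := A⁻¹) hn
    (by
      have e : A⁻¹ - 1 = -(A⁻¹ * (A - 1)) := by field_simp; ring
      rw [e]
      exact ((inIdeal_zero_of_nu_zero (nu_inv_of_nu_zero hA0)).mul_left h1).neg)
    (by rw [map_inv₀, hAfix])
  have hLL : L * L * A = 1 := by rw [hLA, inv_mul_cancel₀ hAne]
  have hLu : S.nu L = 0 := nu_eq_zero_of_sub_one (hL.mono (by exact_mod_cast hn))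
  have hL0 := inIdeal_zero_of_nu_zero hLu
  have hw0 := hw1.mono zero_le_one
  have hdiff : ∀ {x}, S.InIdeal 0 x → S.InIdeal n (x - L * x) := fun {x} hx => by
    have e : x - L * x = -((L - 1) * x) := by ring
    rw [e]
    exact (hL.mul_right hx).neg
  have hG : !![L * k 1 1, L * k 0 1; L * k 0 1 * w, L * k 1 1] ∈ Gset S := by
    rw [mem_Gset_iff]
    simp only [Matrix.of_apply, Matrix.cons_val', Matrix.cons_val_zero, Matrix.cons_val_one,
      Matrix.cons_val_fin_one, map_mul, hLfix, hw]
    refine ⟨?_, ?_, ?_, ?_⟩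
    · linear_combination L * L * w * g4
    · linear_combination hLL + L * L * hA
    · linear_combination hLL + L * L * hA
    · linear_combination L * L * g4
  refine ⟨_, ⟨hG, ?_, nu_det_of_mem_Gset hG⟩, rfl, rfl, ?_⟩
  · change S.MatInIdeal 0 _
    intro i j
    fin_cases i <;> fin_cases j
    exacts [hL0.mul_left (hk0 _ _), hL0.mul_left (hk0 _ _),
      (hL0.mul_left (hk0 _ _)).mul_right hw0, hL0.mul_left (hk0 _ _)]
  · intro i j
    fin_cases i <;> fin_cases j
    · have e : k 0 0 - L * k 1 1 = (k 0 0 - k 1 1) + (k 1 1 - L * k 1 1) := by ring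
      change S.InIdeal n (k 0 0 - L * k 1 1)
      rw [e]
      exact hdelta.add (hdiff (hk0 1 1))
    · simpa using hdiff (hk0 0 1)
    · have e : k 1 0 - L * k 0 1 * w = (k 1 0 - w * k 0 1) + w * (k 0 1 - L * k 0 1) := by ring
      change S.InIdeal n (k 1 0 - L * k 0 1 * w)
      rw [e]
      exact hgamma.add (hw0.mul_left (hdiff (hk0 0 1)))
    · simpa using hdiff (hk0 1 1)

end USetting

/-- the normalizer in `K` of the character `Ψ_X` of `K_{⌊d/2⌋+1}` equals
`T(X)·K_{⌈d/2⌉}`. -/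
theorem stmt12 (S : USetting E) (d : ℕ) (hd : 0 < d) (z u v : E)
    (hz : S.sig z = z) (hu : S.sig u = u) (hv : S.sig v = v)
    (hnz : ((-(d : ℤ) : ℤ) : WithTop ℤ) ≤ S.nu z)
    (hnu : S.nu u = ((-(d : ℤ) : ℤ) : WithTop ℤ))
    (hnv : ((-(d : ℤ) : ℤ) : WithTop ℤ) < S.nu v) :
    {k : Mat E | k ∈ Kset S ∧ ∀ g ∈ Kfil S (((d / 2 : ℕ) : ℤ) + 1),
        PsiC S (Xzuv S z u v) (k * g * k⁻¹) = PsiC S (Xzuv S z u v) g}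
      = {x : Mat E | ∃ t ∈ TXset S u v,
          ∃ h ∈ Kfil S ((((d + 1) / 2 : ℕ)) : ℤ), x = t * h} := by
  have hu0 : u ≠ 0 := by
    rintro rfl
    exact WithTop.top_ne_coe (((S.nu_eq_top 0).2 rfl).symm.trans hnu)
  set w := u⁻¹ * v with hwdef
  have hvw : v = u * w := by rw [hwdef, mul_inv_cancel_left₀ hu0]
  have hw : S.sig w = w := by rw [hwdef, map_mul, map_inv₀, hu, hv]
  have hw1 : S.InIdeal 1 w := by
    rw [hvw, S.nu_mul, hnu] at hnv
    rw [USetting.InIdeal]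
    cases hx : S.nu w with
    | top => exact le_top
    | coe a =>
      rw [hx] at hnv
      norm_cast at *
      omega
  ext k
  constructor
  · rintro ⟨hk, hstab⟩
    rw [hvw] at hstab
    obtain ⟨h1, h3⟩ := USetting.congruences_of_stabilizes (m := ((d / 2 : ℕ) : ℤ) + 1)
      (n := ((d + 1) / 2 : ℕ)) (d := d) (by omega) (by omega) (by omega) hu hw hnu
      (hw1.mono zero_le_one) hk
      fun g hg => (USetting.PsiC_conj_eq_iff hk _ g).1 (hstab g hg)
    obtain ⟨t, ht, ht1, ht2, hkt⟩ :=
      USetting.exists_centralizer_congr (by omega) hw hw1 hk h1 h3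
    have htu := USetting.isUnit_det_of_mem_Kset ht
    refine ⟨t, ⟨ht, ht1, ht2⟩, t⁻¹ * k,
      ⟨USetting.mul_mem_Kset (USetting.inv_mem_Kset ht) hk, ?_⟩,
      (Matrix.mul_nonsing_inv_cancel_left t k htu).symm⟩
    have e : t⁻¹ * k - 1 = t⁻¹ * (k - t) := by
      rw [Matrix.mul_sub, Matrix.nonsing_inv_mul t htu]
    rw [e]
    exact ((USetting.matInIdeal_inv_of_mem_Kset ht).mul hkt).mono (zero_add _).ge
  · rintro ⟨t, ht, h, ⟨hhK, hh⟩, rfl⟩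
    have hK := USetting.mul_mem_Kset ht.1 hhK
    refine ⟨hK, fun g hg => (USetting.PsiC_conj_eq_iff hK _ g).2 (USetting.psiE_eq_one ?_)⟩
    have htu := USetting.isUnit_det_of_mem_Kset ht.1
    have hhu := USetting.isUnit_det_of_mem_Kset hhK
    set X := Xzuv S z u v with hX
    have hXI : S.MatInIdeal (-d) X := USetting.matInIdeal_Xzuv hnz hnu.ge hnv.le
    have hcomm : X * t = t * X := USetting.commute_Xzuv_of_mem_TXset hu0 ht
    have e : (t * h)⁻¹ * X * (t * h) - X = h⁻¹ * (X * (h - 1) - (h - 1) * X) := by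
      have e1 : (t * h)⁻¹ * X * (t * h) = h⁻¹ * X * h := by
        calc _ = h⁻¹ * (t⁻¹ * (X * t)) * h := by
              rw [Matrix.mul_inv_rev]; simp only [Matrix.mul_assoc]
          _ = h⁻¹ * X * h := by rw [hcomm, Matrix.nonsing_inv_mul_cancel_left t X htu]
      have e2 : X * (h - 1) - (h - 1) * X = X * h - h * X := by noncomm_ring
      rw [e1, e2, Matrix.mul_sub, Matrix.nonsing_inv_mul_cancel_left h X hhu, Matrix.mul_assoc]
    rw [e]
    have hh' : S.MatInIdeal ((d + 1) / 2 : ℕ) (h - 1) := hh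
    have hg' : S.MatInIdeal (((d / 2 : ℕ) : ℤ) + 1) (g - 1) := hg.2
    have hb := ((hXI.mul hh').mono (show -((d / 2 : ℕ) : ℤ) ≤ _ by omega)).sub
      ((hh'.mul hXI).mono (show -((d / 2 : ℕ) : ℤ) ≤ _ by omega))
    exact ((((USetting.matInIdeal_inv_of_mem_Kset hhK).mul hb).mul hg').mono (by omega)).trace
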